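/- Let Ω, Ω* be bounded convex open sets in ℝⁿ, let p₁,…,p_N be distinct points in Ω̄* (N ≥ 2), g₁,…,g_N > 0, and f ∈ L¹(Ω), f ≥ 0, with ∫_Ω f dx = Σᵢ gᵢ. Then there exist real numbers b₁,…,b_N such that the convex function u(x) = max_{1≤i≤N} (x·pᵢ + bᵢ) solves the second boundary value problem for the Monge–Ampère equation with these data: for every Borel set E ⊆ Ω̄*, ∫_{(∂u)⁻¹(E)} f dx = Σ_{i : pᵢ∈E} gᵢ; in particular ∫_{(∂u)⁻¹({pᵢ})} f dx = gᵢ for each i. -/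

import Mathlib

open MeasureTheory
open scoped RealInnerProductSpace

/-- The subdifferential of `u` at `x₀`, constrained to `Ω̄*`:
`∂u(x₀) = {p ∈ Ω̄* : u(x) ≥ u(x₀) + p·(x − x₀) for all x ∈ Ω̄}`. -/
def csubdiff {n : ℕ} (Ωc Ωsc : Set (EuclideanSpace ℝ (Fin n)))
    (u : EuclideanSpace ℝ (Fin n) → ℝ) (x₀ : EuclideanSpace ℝ (Fin n)) :
    Set (EuclideanSpace ℝ (Fin n)) :=
  {p | p ∈ Ωsc ∧ ∀ x ∈ Ωc, u x₀ + ⟪p, x - x₀⟫ ≤ u x}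

/-- `(∂u)⁻¹(E) = {x ∈ Ω̄ : ∂u(x) ∩ E ≠ ∅}`. -/
def csubdiffPreimage {n : ℕ} (Ωc Ωsc : Set (EuclideanSpace ℝ (Fin n)))
    (u : EuclideanSpace ℝ (Fin n) → ℝ) (E : Set (EuclideanSpace ℝ (Fin n))) :
    Set (EuclideanSpace ℝ (Fin n)) :=
  {x | x ∈ Ωc ∧ (csubdiff Ωc Ωsc u x ∩ E).Nonempty}

section helpers

/-- The upper envelope of finitely many functions shifted by constants. -/
noncomputable def envU {X : Type*} {N : ℕ} (c : Fin N → X → ℝ) (b : Fin N → ℝ) (x : X) : ℝ :=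
  ⨆ i, (c i x + b i)

/-- The cell on which the `i`-th function is maximal. -/
def cellV {X : Type*} {N : ℕ} (c : Fin N → X → ℝ) (b : Fin N → ℝ) (i : Fin N) : Set X :=
  {x | ∀ j, c j x + b j ≤ c i x + b i}

lemma le_envU {X : Type*} {N : ℕ} (c : Fin N → X → ℝ) (b : Fin N → ℝ) (x : X) (i : Fin N) :
    c i x + b i ≤ envU c b x :=
  le_ciSup (f := fun i => c i x + b i) (Set.finite_range _).bddAbove i

lemma envU_le {X : Type*} {N : ℕ} [NeZero N] (c : Fin N → X → ℝ) (b : Fin N → ℝ) (x : X) (a : ℝ)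
    (h : ∀ i, c i x + b i ≤ a) : envU c b x ≤ a :=
  ciSup_le h

lemma exists_envU {X : Type*} {N : ℕ} [NeZero N] (c : Fin N → X → ℝ) (b : Fin N → ℝ) (x : X) :
    ∃ i, c i x + b i = envU c b x :=
  exists_eq_ciSup_of_finite (f := fun i => c i x + b i)

lemma measurableSet_cellV {X : Type*} [MeasurableSpace X] {N : ℕ} (c : Fin N → X → ℝ)
    (hc : ∀ i, Measurable (c i)) (b : Fin N → ℝ) (i : Fin N) : MeasurableSet (cellV c b i) := by
  have : cellV c b i = ⋂ j, {x | c j x + b j ≤ c i x + b i} := by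
    ext x; simp [cellV]
  rw [this]
  exact MeasurableSet.iInter fun j =>
    measurableSet_le ((hc j).add_const _) ((hc i).add_const _)

lemma envU_update_le {X : Type*} {N : ℕ} [NeZero N] (c : Fin N → X → ℝ) (b : Fin N → ℝ)
    (i : Fin N) (t : ℝ) (x : X) :
    envU c (Function.update b i (b i + t)) x ≤ envU c b x +
      (cellV c (Function.update b i (b i + t)) i).indicator (fun _ => t) x := by
  set b' := Function.update b i (b i + t) with hb'
  obtain ⟨k, hk⟩ := exists_envU c b' x
  by_cases hx : x ∈ cellV c b' i
  · rw [Set.indicator_of_mem hx]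
    apply envU_le
    intro j
    have h1 := hx j
    have h2 := le_envU c b x i
    have h3 : b' i = b i + t := by simp [hb']
    linarith
  · rw [Set.indicator_of_notMem hx, ← hk, add_zero]
    have hki : k ≠ i := by
      rintro rfl
      exact hx fun j => hk ▸ le_envU c b' x j
    have : b' k = b k := by simp [hb', hki]
    rw [this]
    exact le_envU c b x k

lemma envU_lip {X : Type*} {N : ℕ} [NeZero N] (c : Fin N → X → ℝ) (b b' : Fin N → ℝ) (x : X) :
    envU c b x ≤ envU c b' x + dist b b' := by
  apply envU_le
  intro i
  have h1 := le_envU c b' x i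
  have h2 : b i - b' i ≤ dist b b' :=
    (le_abs_self _).trans ((Real.dist_eq _ _).symm ▸ dist_le_pi_dist b b' i)
  linarith

theorem exists_cells {X : Type*} [MeasurableSpace X] (μ : Measure X) [IsFiniteMeasure μ]
    {N : ℕ} [NeZero N] (c : Fin N → X → ℝ) (hc : ∀ i, Measurable (c i))
    (M : ℝ) (hM : ∀ᵐ x ∂μ, ∀ i, |c i x| ≤ M)
    (hties : ∀ i j, i ≠ j → ∀ t, μ {x | c i x - c j x = t} = 0)
    (g : Fin N → ℝ) (hg : ∀ i, 0 < g i) (hmass : μ.real Set.univ = ∑ i, g i) :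
    ∃ b : Fin N → ℝ, ∀ i, μ.real (cellV c b i) = g i := by
  set G := ∑ i, g i with hG
  have hmeas : ∀ b, Measurable (envU c b) := fun b =>
    Measurable.iSup fun i => (hc i).add_const _
  have hInt : ∀ b, Integrable (envU c b) μ := by
    intro b
    refine Integrable.of_bound (hmeas b).aestronglyMeasurable (M + ‖b‖) ?_
    filter_upwards [hM] with x hx
    obtain ⟨k, hk⟩ := exists_envU c b x
    rw [← hk, Real.norm_eq_abs]
    refine (abs_add_le _ _).trans (add_le_add (hx k) ?_)
    exact norm_le_pi_norm b k
  set Φ : (Fin N → ℝ) → ℝ := fun b => (∫ x, envU c b x ∂μ) - ∑ i, g i * b i with hΦ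
  have hlip : ∀ b b', (∫ x, envU c b x ∂μ) ≤ (∫ x, envU c b' x ∂μ) + G * dist b b' := by
    intro b b'
    calc (∫ x, envU c b x ∂μ) ≤ ∫ x, (envU c b' x + dist b b') ∂μ :=
          integral_mono (hInt b) ((hInt b').add (integrable_const _)) (envU_lip c b b')
      _ = _ := by
          rw [integral_add (hInt b') (integrable_const _), integral_const, hmass, smul_eq_mul]
  have hG0 : 0 ≤ G := Finset.sum_nonneg fun i _ => (hg i).le
  have hcont : Continuous Φ := by
    refine Continuous.sub ?_ (by fun_prop)
    refine (LipschitzWith.of_le_add_mul ⟨G, hG0⟩ ?_).continuous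
    intro b b'
    exact hlip b b'
  have hinv : ∀ b s, Φ (fun i => b i + s) = Φ b := by
    intro b s
    have h1 : ∀ x, envU c (fun i => b i + s) x = envU c b x + s := by
      intro x
      apply le_antisymm
      · apply envU_le
        intro i
        have := le_envU c b x i
        linarith
      · obtain ⟨k, hk⟩ := exists_envU c b x
        have := le_envU c (fun i => b i + s) x k
        linarith
    simp only [hΦ, h1, mul_add, Finset.sum_add_distrib]
    rw [integral_add (hInt b) (integrable_const _), integral_const, hmass, smul_eq_mul,
      ← Finset.sum_mul]
    ring
  have hcoer : ∀ b, (∀ i, b i ≤ 0) → ∀ k, b k = 0 → ∀ i, g i * (-b i) - M * G ≤ Φ b := by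
    intro b hb k hk i
    have h1 : (∫ x, (-M : ℝ) ∂μ) ≤ ∫ x, envU c b x ∂μ := by
      refine integral_mono_ae (integrable_const _) (hInt b) ?_
      filter_upwards [hM] with x hx
      have h2 := le_envU c b x k
      have h3 := neg_le_of_abs_le (hx k)
      linarith
    rw [integral_const, hmass, smul_eq_mul] at h1
    have h2 : g i * (-b i) ≤ ∑ j, g j * (-b j) :=
      Finset.single_le_sum (f := fun j => g j * (-b j))
        (fun j _ => mul_nonneg (hg j).le (by linarith [hb j])) (Finset.mem_univ i)
    simp only [mul_neg, Finset.sum_neg_distrib] at h2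
    simp only [hΦ]
    linarith
  obtain ⟨i0, hi0⟩ := Finite.exists_min g
  set R : ℝ := max 0 ((M * G + Φ 0) / g i0) with hR
  have hRnn : 0 ≤ R := le_max_left _ _
  have hR2 : M * G + Φ 0 ≤ g i0 * R := by
    have := le_max_right 0 ((M * G + Φ 0) / g i0)
    rw [← hR, div_le_iff₀ (hg i0)] at this
    linarith
  obtain ⟨b, hbK, hbmin⟩ := (isCompact_Icc (a := fun _ : Fin N => -R)
    (b := fun _ : Fin N => (0:ℝ))).exists_isMinOn ⟨0, fun _ => by simpa using hRnn, fun _ => le_rfl⟩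
    hcont.continuousOn
  have hmin : ∀ b', Φ b ≤ Φ b' := by
    intro b'
    obtain ⟨k, hk⟩ := Finite.exists_max b'
    rw [← hinv b' (-b' k)]
    set b'' : Fin N → ℝ := fun i => b' i + -b' k with hb''
    have hneg : ∀ i, b'' i ≤ 0 := fun i => by simp only [hb'']; linarith [hk i]
    by_cases h : ∀ i, -R ≤ b'' i
    · exact hbmin ⟨h, hneg⟩
    · push Not at h
      obtain ⟨i, hi⟩ := h
      have h1 := hcoer b'' hneg k (by simp [hb'']) i
      have h2 : Φ b ≤ Φ 0 := hbmin ⟨fun _ => by simpa using hRnn, fun _ => le_rfl⟩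
      have h3 : g i0 * R ≤ g i * (-b'' i) :=
        mul_le_mul (hi0 i) (by linarith) hRnn (hg i).le
      linarith
  have hpert : ∀ i, ∀ t > 0, g i ≤ μ.real (cellV c (Function.update b i (b i + t)) i) := by
    intro i t ht
    set b' := Function.update b i (b i + t) with hb'
    have hV := measurableSet_cellV c hc b' i
    have h1 : (∫ x, envU c b' x ∂μ) ≤ (∫ x, envU c b x ∂μ) + t * μ.real (cellV c b' i) := by
      have hI : Integrable ((cellV c b' i).indicator (fun _ => t)) μ :=
        (integrable_const t).indicator hV
      calc (∫ x, envU c b' x ∂μ) ≤ ∫ x, (envU c b x + (cellV c b' i).indicator (fun _ => t) x) ∂μ :=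
            integral_mono (hInt b') ((hInt b).add hI) (envU_update_le c b i t)
        _ = _ := by
            rw [integral_add (hInt b) hI, integral_indicator_const _ hV, smul_eq_mul, mul_comm]
    have h2 := hmin b'
    have h3 : ∑ j, g j * b' j = ∑ j, g j * b j + g i * t := by
      have : ∀ j, g j * b' j = g j * b j + (if j = i then g i * t else 0) := by
        intro j
        by_cases hj : j = i
        · subst hj; simp [hb', mul_add]
        · simp [hb', hj]
      simp [this, Finset.sum_add_distrib]
    simp only [hΦ, h3] at h2
    have h4 : t * g i ≤ t * μ.real (cellV c b' i) := by linarith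
    exact le_of_mul_le_mul_left h4 ht
  have hge : ∀ i, g i ≤ μ.real (cellV c b i) := by
    intro i
    have hmem : ∀ t x, x ∈ cellV c (Function.update b i (b i + t)) i ↔
        ∀ j, j ≠ i → c j x + b j ≤ c i x + b i + t := by
      intro t x
      constructor
      · intro h j hj
        have := h j
        simp [hj] at this
        linarith
      · intro h j
        by_cases hj : j = i
        · subst hj; exact le_rfl
        · have := h j hj
          simp [hj]
          linarith
    have hEq : cellV c b i = ⋂ m : ℕ, cellV c (Function.update b i (b i + 1 / ((m:ℝ) + 1))) i := by
      ext x
      simp only [Set.mem_iInter, hmem]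
      constructor
      · intro h m j hj
        have := h j
        have : 0 < 1 / ((m:ℝ) + 1) := by positivity
        linarith
      · intro h j
        by_cases hj : j = i
        · subst hj; exact le_rfl
        · refine le_of_forall_pos_le_add fun ε hε => ?_
          obtain ⟨m, hm⟩ := exists_nat_one_div_lt hε
          have := h m j hj
          linarith
    have hanti : Antitone fun m : ℕ => cellV c (Function.update b i (b i + 1 / ((m:ℝ) + 1))) i := by
      intro m k hmk x hx
      simp only [hmem] at hx ⊢
      intro j hj
      have h1 := hx j hj
      have h2 : 1 / ((k:ℝ) + 1) ≤ 1 / ((m:ℝ) + 1) := Nat.one_div_le_one_div hmk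
      linarith
    have ht := tendsto_measure_iInter_atTop (μ := μ)
      (fun m : ℕ => (measurableSet_cellV c hc (Function.update b i (b i + 1 / ((m:ℝ) + 1)))
        i).nullMeasurableSet) hanti ⟨0, measure_ne_top _ _⟩
    rw [← hEq] at ht
    have ht2 := (ENNReal.tendsto_toReal (measure_ne_top μ (cellV c b i))).comp ht
    exact ge_of_tendsto' ht2 fun m => hpert i _ (by positivity)
  have hdisj : Pairwise (Function.onFun (AEDisjoint μ) fun i => cellV c b i) := by
    intro i j hij
    refine measure_mono_null ?_ (hties i j hij (b j - b i))
    rintro x ⟨hx1, hx2⟩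
    have h1 := hx1 j
    have h2 := hx2 i
    simp only [Set.mem_setOf_eq]
    linarith
  have hsum : ∑ i, μ.real (cellV c b i) ≤ ∑ i, g i := by
    rw [← hG, ← hmass]
    have h := measure_iUnion₀ hdisj fun i => (measurableSet_cellV c hc b i).nullMeasurableSet
    rw [tsum_fintype] at h
    simp only [Measure.real]
    rw [← ENNReal.toReal_sum fun _ _ => measure_ne_top _ _, ← h]
    exact ENNReal.toReal_mono (measure_ne_top _ _) (measure_mono (Set.subset_univ _))
  refine ⟨b, fun i => ?_⟩
  have := (Finset.sum_eq_sum_iff_of_le (s := Finset.univ) fun i _ => hge i).1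
    (le_antisymm (Finset.sum_le_sum fun i _ => hge i) hsum) i (Finset.mem_univ i)
  exact this.symm

lemma volume_hyperplane {n : ℕ} (v : EuclideanSpace ℝ (Fin n)) (hv : v ≠ 0) (t : ℝ) :
    volume {x : EuclideanSpace ℝ (Fin n) | ⟪x, v⟫ = t} = 0 := by
  rcases Set.eq_empty_or_nonempty {x : EuclideanSpace ℝ (Fin n) | ⟪x, v⟫ = t} with h | ⟨x0, hx0⟩
  · rw [h]; simp
  · have hx0 : ⟪x0, v⟫ = t := hx0
    have hne : ⟪v, v⟫ ≠ (0:ℝ) := inner_self_ne_zero.2 hv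
    have h := Measure.addHaar_affineSubspace (volume : Measure (EuclideanSpace ℝ (Fin n)))
      (AffineSubspace.mk' x0 (LinearMap.ker (innerₛₗ ℝ v))) ?_
    · refine measure_mono_null ?_ h
      intro x hx
      have hx : ⟪x, v⟫ = t := hx
      simp [AffineSubspace.mem_mk', inner_sub_right, real_inner_comm, hx, hx0]
      try (rw [real_inner_comm, hx, real_inner_comm, hx0, sub_self])
    · intro htop
      have : x0 + v ∈ AffineSubspace.mk' x0 (LinearMap.ker (innerₛₗ ℝ v)) := by
        rw [htop]; trivial
      rw [AffineSubspace.mem_mk'] at this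
      simp at this
      exact hv this

lemma mem_preimage_iff {n : ℕ} (Ω Ωs : Set (EuclideanSpace ℝ (Fin n))) (hΩopen : IsOpen Ω)
    {N : ℕ} [NeZero N] (p : Fin N → EuclideanSpace ℝ (Fin n)) (hpmem : ∀ i, p i ∈ closure Ωs)
    (b : Fin N → ℝ) (E : Set (EuclideanSpace ℝ (Fin n))) (x : EuclideanSpace ℝ (Fin n))
    (hx : x ∈ Ω) (hnt : ∀ i j, i ≠ j → ⟪x, p i⟫ + b i ≠ ⟪x, p j⟫ + b j) :
    x ∈ csubdiffPreimage (closure Ω) (closure Ωs) (fun z => ⨆ i, (⟪z, p i⟫ + b i)) E ↔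
      ∃ i, p i ∈ E ∧ x ∈ cellV (fun i z => ⟪z, p i⟫) b i := by
  set c : Fin N → EuclideanSpace ℝ (Fin n) → ℝ := fun i z => ⟪z, p i⟫ with hc
  have hu : (fun z => ⨆ i, (⟪z, p i⟫ + b i)) = envU c b := rfl
  rw [hu]
  constructor
  · rintro ⟨-, q, ⟨-, hq⟩, hqE⟩
    obtain ⟨k, hk⟩ := exists_envU c b x
    have hxk : x ∈ cellV c b k := fun j => hk ▸ le_envU c b x j
    have hlt : ∀ j, j ≠ k → c j x + b j < c k x + b k := fun j hj =>
      lt_of_le_of_ne (hxk j) (hnt j k hj)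
    have hcc : ∀ j, Continuous (c j) := fun j => by simp only [hc]; fun_prop
    have hev : ∀ᶠ z in nhds x, z ∈ Ω ∧ ∀ j, c j z + b j ≤ c k z + b k := by
      refine Filter.Eventually.and (hΩopen.mem_nhds hx) (Filter.eventually_all.2 fun j => ?_)
      by_cases hj : j = k
      · subst hj; simp
      · have := ((hcc j).add continuous_const).continuousAt.eventually_lt
          ((hcc k).add continuous_const).continuousAt (hlt j hj)
        filter_upwards [this] with z hz using hz.le
    have hpath : Filter.Tendsto (fun s : ℝ => x + s • (q - p k)) (nhdsWithin 0 (Set.Ioi 0))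
        (nhds x) := by
      have : Continuous (fun s : ℝ => x + s • (q - p k)) := by fun_prop
      have h := this.tendsto 0
      simp only [zero_smul, add_zero] at h
      exact h.mono_left nhdsWithin_le_nhds
    obtain ⟨s, ⟨hzΩ, hz⟩, hs⟩ := ((hpath.eventually hev).and self_mem_nhdsWithin).exists
    have hs : 0 < s := hs
    have h1 := hq _ (subset_closure hzΩ)
    have h2 := envU_le c b _ _ hz
    rw [← hk] at h1
    simp only [hc, inner_add_left, inner_smul_left, inner_smul_right, add_sub_cancel_left] at h1 h2
    have h3 : ⟪q - p k, q - p k⟫ = ⟪q, q - p k⟫ - ⟪q - p k, p k⟫ := by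
      rw [inner_sub_left, real_inner_comm (p k) (q - p k)]
    simp only [conj_trivial] at h1 h2
    have h4 : s * ⟪q - p k, q - p k⟫ ≤ 0 := by
      rw [h3, mul_sub]; linarith
    have h5 : ⟪q - p k, q - p k⟫ ≤ (0:ℝ) := by
      by_contra hcon
      push Not at hcon
      have := mul_pos hs hcon
      linarith
    have h6 : q - p k = 0 := inner_self_eq_zero.1 (le_antisymm h5 real_inner_self_nonneg)
    have h7 : q = p k := sub_eq_zero.1 h6
    exact ⟨k, h7 ▸ hqE, hxk⟩
  · rintro ⟨i, hiE, hi⟩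
    refine ⟨subset_closure hx, p i, ⟨hpmem i, fun z _ => ?_⟩, hiE⟩
    have h1 := envU_le c b x _ hi
    have h2 := le_envU c b z i
    simp only [hc] at h1 h2
    rw [inner_sub_right, real_inner_comm, real_inner_comm x (p i)]
    linarith

end helpers

/-- Theorem 7.4: solution of the second boundary value problem for the Monge–Ampère equation
when the target measure is a finite combination of Dirac deltas: there are `b₁,…,b_N` such
that the convex function `u(x) = max_i (x·pᵢ + bᵢ)` satisfies
`∫_{(∂u)⁻¹(E)} f dx = Σ_{i : pᵢ ∈ E} gᵢ` for every Borel `E ⊆ Ω̄*`. -/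
theorem stmt19 {n : ℕ} (Ω Ωs : Set (EuclideanSpace ℝ (Fin n)))
    -- Ω and Ω* are bounded convex open sets
    (hΩconv : Convex ℝ Ω) (hΩopen : IsOpen Ω) (hΩbdd : Bornology.IsBounded Ω)
    (hΩsconv : Convex ℝ Ωs) (hΩsopen : IsOpen Ωs) (hΩsbdd : Bornology.IsBounded Ωs)
    -- the data: distinct points pᵢ ∈ Ω̄*, positive energies, f ∈ L¹(Ω) nonnegative
    {N : ℕ} [NeZero N] (hN : 2 ≤ N)
    (p : Fin N → EuclideanSpace ℝ (Fin n)) (hpmem : ∀ i, p i ∈ closure Ωs)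
    (hpinj : Function.Injective p)
    (g : Fin N → ℝ) (hg : ∀ i, 0 < g i)
    (f : EuclideanSpace ℝ (Fin n) → ℝ) (hfmeas : Measurable f)
    (hfnn : ∀ᵐ x ∂(volume.restrict Ω), 0 ≤ f x)
    -- conservation of energy
    (hmass : ∫⁻ x in Ω, ENNReal.ofReal (f x) ∂volume = ∑ i, ENNReal.ofReal (g i)) :
    ∃ b : Fin N → ℝ,
      ∀ E : Set (EuclideanSpace ℝ (Fin n)), MeasurableSet E → E ⊆ closure Ωs →
        ∫⁻ x in csubdiffPreimage (closure Ω) (closure Ωs)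
            (fun z => ⨆ i, (⟪z, p i⟫ + b i)) E, ENNReal.ofReal (f x) ∂volume =
          ∑ i, E.indicator (fun _ => ENNReal.ofReal (g i)) (p i) := by
  classical
  set F : EuclideanSpace ℝ (Fin n) → ENNReal := fun x => ENNReal.ofReal (f x) with hF
  have hFm : Measurable F := hfmeas.ennreal_ofReal
  set μ : Measure (EuclideanSpace ℝ (Fin n)) := (volume.restrict Ω).withDensity F with hμ
  have hμac : μ ≪ volume :=
    (withDensity_absolutelyContinuous _ _).trans Measure.absolutelyContinuous_restrict
  have huniv : μ Set.univ = ∑ i, ENNReal.ofReal (g i) := by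
    rw [hμ, withDensity_apply _ MeasurableSet.univ, Measure.restrict_univ]; exact hmass
  have hfin : IsFiniteMeasure μ := ⟨by rw [huniv]; simp⟩
  set c : Fin N → EuclideanSpace ℝ (Fin n) → ℝ := fun i z => ⟪z, p i⟫ with hc
  have hcm : ∀ i, Measurable (c i) := fun i => by
    have : Continuous (c i) := by simp only [hc]; fun_prop
    exact this.measurable
  have hΩae : ∀ᵐ x ∂μ, x ∈ Ω :=
    (withDensity_absolutelyContinuous _ _).ae_le (ae_restrict_mem hΩopen.measurableSet)
  obtain ⟨A, hA⟩ := hΩbdd.exists_norm_le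
  obtain ⟨B, hB⟩ := hΩsbdd.closure.exists_norm_le
  have hM : ∀ᵐ x ∂μ, ∀ i, |c i x| ≤ A * B := by
    filter_upwards [hΩae] with x hx i
    refine (abs_real_inner_le_norm _ _).trans ?_
    exact mul_le_mul (hA x hx) (hB _ (hpmem i)) (norm_nonneg _) ((norm_nonneg _).trans (hA x hx))
  have hvt : ∀ i j, i ≠ j → ∀ t, volume {x | c i x - c j x = t} = 0 := by
    intro i j hij t
    have := volume_hyperplane (p i - p j) (sub_ne_zero.2 fun h => hij (hpinj h)) t
    simpa only [hc, inner_sub_right] using this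
  have hmass' : μ.real Set.univ = ∑ i, g i := by
    rw [Measure.real, huniv, ENNReal.toReal_sum fun _ _ => ENNReal.ofReal_ne_top]
    exact Finset.sum_congr rfl fun i _ => ENNReal.toReal_ofReal (hg i).le
  obtain ⟨b, hb⟩ := exists_cells μ c hcm (A * B) hM
    (fun i j hij t => hμac (hvt i j hij t)) g hg hmass'
  refine ⟨b, fun E hE hEs => ?_⟩
  have hbE : ∀ i, μ (cellV c b i) = ENNReal.ofReal (g i) := fun i => by
    rw [← hb i, Measure.real, ENNReal.ofReal_toReal (measure_ne_top _ _)]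
  set T : Finset (Fin N) := Finset.univ.filter fun i => p i ∈ E with hT
  have hTm : MeasurableSet (⋃ i ∈ T, cellV c b i) :=
    T.measurableSet_biUnion fun i _ => measurableSet_cellV c hcm b i
  have hfr : volume (frontier Ω) = 0 := hΩconv.addHaar_frontier volume
  have hnt : ∀ᵐ x ∂(volume : Measure (EuclideanSpace ℝ (Fin n))),
      ∀ i j, i ≠ j → ⟪x, p i⟫ + b i ≠ ⟪x, p j⟫ + b j := by
    rw [ae_all_iff]; intro i
    rw [ae_all_iff]; intro j
    by_cases hij : i = j
    · simp [hij]
    · refine measure_mono_null ?_ (hvt i j hij (b j - b i))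
      intro x hx
      simp only [ne_eq, Set.mem_compl_iff, Set.mem_setOf_eq] at hx ⊢
      push Not at hx
      simp only [hc]
      linarith [hx.2]
  have hfr' : ∀ᵐ x ∂(volume : Measure (EuclideanSpace ℝ (Fin n))), x ∉ frontier Ω :=
    measure_eq_zero_iff_ae_notMem.1 hfr
  have hSae : csubdiffPreimage (closure Ω) (closure Ωs)
      (fun z => ⨆ i, (⟪z, p i⟫ + b i)) E =ᵐ[volume]
      ((⋃ i ∈ T, cellV c b i) ∩ Ω : Set (EuclideanSpace ℝ (Fin n))) := by
    rw [Filter.eventuallyEq_set]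
    filter_upwards [hnt, hfr'] with x hx hxf
    by_cases hxΩ : x ∈ Ω
    · rw [mem_preimage_iff Ω Ωs hΩopen p hpmem b E x hxΩ hx]
      simp [hT, hxΩ, hc]
    · have : x ∉ closure Ω := fun h => hxf (by rw [hΩopen.frontier_eq]; exact ⟨h, hxΩ⟩)
      constructor
      · intro h; exact absurd h.1 this
      · intro h; exact absurd h.2 hxΩ
  rw [setLIntegral_congr hSae, ← Measure.restrict_restrict hTm, ← withDensity_apply _ hTm, ← hμ,
    measure_biUnion_finset₀ ?_ fun i _ => (measurableSet_cellV c hcm b i).nullMeasurableSet]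
  · rw [hT, Finset.sum_filter]
    refine Finset.sum_congr rfl fun i _ => ?_
    by_cases hi : p i ∈ E
    · simp [hi, hbE]
    · simp [hi]
  · intro i _ j _ hij
    refine measure_mono_null ?_ (hμac (hvt i j hij (b j - b i)))
    rintro x ⟨hx1, hx2⟩
    have h1 := hx1 j
    have h2 := hx2 i
    simp only [Set.mem_setOf_eq]
    linarith
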